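/- Let N ≥ 1 and let α = (α_0,…,α_{N−1}) assign to each stage a set of state rows and a set of input rows. For a horizon M and a stage-wise pattern β, let P_M(β) denote the set of initial states in F_M whose horizon-M active pattern equals β at every stage and has no active terminal rows, and let 0^j denote j stages with no active rows. Then for every 0 ≤ l ≤ N−1 and every j ≥ 0: P_{N−l}(α_l,…,α_{N−1}) = P_{N−l+j}((α_l,…,α_{N−1})0^j); in particular the polytope defined by the truncated pattern (α_l,…,α_{N−1}) with empty terminal part is persistent from horizon N−l on, and it equals the horizon-N polytope defined by the padded pattern (α_l,…,α_{N−1},0,…,0) with l fully inactive stages and empty terminal part. Moreover, for every x0 ∈ P_N(α) and every 0 ≤ l ≤ N−1, the optimal state x*_N(x0,l) belongs to P_{N−l}(α_l,…,α_{N−1}). -/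

import Mathlib

open Matrix Set

noncomputable section

/-- State trajectory generated by dynamics `x(k+1) = A x(k) + B u(k)` from `x0`. -/
def traj {n m : ℕ} (A : Matrix (Fin n) (Fin n) ℝ) (B : Matrix (Fin n) (Fin m) ℝ)
    (x0 : Fin n → ℝ) (u : ℕ → Fin m → ℝ) : ℕ → Fin n → ℝ
  | 0 => x0
  | k + 1 => A *ᵥ traj A B x0 u k + B *ᵥ u k

/-- Feasibility of a control sequence for horizon `N` and initial state `x0`. -/
def Feasible {n m qX qU qT : ℕ} (A : Matrix (Fin n) (Fin n) ℝ) (B : Matrix (Fin n) (Fin m) ℝ)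
    (Cx : Matrix (Fin qX) (Fin n) ℝ) (cx : Fin qX → ℝ)
    (Cu : Matrix (Fin qU) (Fin m) ℝ) (cu : Fin qU → ℝ)
    (Ct : Matrix (Fin qT) (Fin n) ℝ) (ct : Fin qT → ℝ)
    (N : ℕ) (x0 : Fin n → ℝ) (u : ℕ → Fin m → ℝ) : Prop :=
  (∀ k < N, Cx *ᵥ traj A B x0 u k ≤ cx ∧ Cu *ᵥ u k ≤ cu) ∧
    Ct *ᵥ traj A B x0 u N ≤ ct

/-- The quadratic cost `J_N(x0, u)`. -/
def cost {n m : ℕ} (A : Matrix (Fin n) (Fin n) ℝ) (B : Matrix (Fin n) (Fin m) ℝ)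
    (Q : Matrix (Fin n) (Fin n) ℝ) (R : Matrix (Fin m) (Fin m) ℝ)
    (P : Matrix (Fin n) (Fin n) ℝ)
    (N : ℕ) (x0 : Fin n → ℝ) (u : ℕ → Fin m → ℝ) : ℝ :=
  (1 / 2) * (traj A B x0 u N ⬝ᵥ (P *ᵥ traj A B x0 u N)) +
    (1 / 2) * ∑ k ∈ Finset.range N,
      (traj A B x0 u k ⬝ᵥ (Q *ᵥ traj A B x0 u k) + u k ⬝ᵥ (R *ᵥ u k))

/-- `u` is an optimal (feasible, cost-minimizing) sequence for horizon `N` at `x0`. -/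
def IsOptimal {n m qX qU qT : ℕ} (A : Matrix (Fin n) (Fin n) ℝ) (B : Matrix (Fin n) (Fin m) ℝ)
    (Q : Matrix (Fin n) (Fin n) ℝ) (R : Matrix (Fin m) (Fin m) ℝ)
    (P : Matrix (Fin n) (Fin n) ℝ)
    (Cx : Matrix (Fin qX) (Fin n) ℝ) (cx : Fin qX → ℝ)
    (Cu : Matrix (Fin qU) (Fin m) ℝ) (cu : Fin qU → ℝ)
    (Ct : Matrix (Fin qT) (Fin n) ℝ) (ct : Fin qT → ℝ)
    (N : ℕ) (x0 : Fin n → ℝ) (u : ℕ → Fin m → ℝ) : Prop :=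
  Feasible A B Cx cx Cu cu Ct ct N x0 u ∧
    ∀ v, Feasible A B Cx cx Cu cu Ct ct N x0 v →
      cost A B Q R P N x0 u ≤ cost A B Q R P N x0 v

/-- The feasible set `F_N` of initial states. -/
def FeasSet {n m qX qU qT : ℕ} (A : Matrix (Fin n) (Fin n) ℝ) (B : Matrix (Fin n) (Fin m) ℝ)
    (Cx : Matrix (Fin qX) (Fin n) ℝ) (cx : Fin qX → ℝ)
    (Cu : Matrix (Fin qU) (Fin m) ℝ) (cu : Fin qU → ℝ)
    (Ct : Matrix (Fin qT) (Fin n) ℝ) (ct : Fin qT → ℝ)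
    (N : ℕ) : Set (Fin n → ℝ) :=
  {x0 | ∃ u, Feasible A B Cx cx Cu cu Ct ct N x0 u}

/-- The set `P_{N+l}(α 0^l)` of initial states whose horizon-`(N+l)` active pattern equals `α`
at the stages `0, …, N-1`, has no active state or input rows at the stages `N, …, N+l-1`,
and has no active terminal rows. -/
def PolyPad {n m qX qU qT : ℕ} (A : Matrix (Fin n) (Fin n) ℝ) (B : Matrix (Fin n) (Fin m) ℝ)
    (Q : Matrix (Fin n) (Fin n) ℝ) (R : Matrix (Fin m) (Fin m) ℝ)
    (P : Matrix (Fin n) (Fin n) ℝ)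
    (Cx : Matrix (Fin qX) (Fin n) ℝ) (cx : Fin qX → ℝ)
    (Cu : Matrix (Fin qU) (Fin m) ℝ) (cu : Fin qU → ℝ)
    (Ct : Matrix (Fin qT) (Fin n) ℝ) (ct : Fin qT → ℝ)
    (N l : ℕ) (α : ℕ → Set (Fin qX) × Set (Fin qU)) : Set (Fin n → ℝ) :=
  {x0 | ∃ u, IsOptimal A B Q R P Cx cx Cu cu Ct ct (N + l) x0 u ∧
    (∀ k < N, (∀ i, (Cx *ᵥ traj A B x0 u k) i = cx i ↔ i ∈ (α k).1) ∧
              (∀ j, (Cu *ᵥ u k) j = cu j ↔ j ∈ (α k).2)) ∧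
    (∀ k, N ≤ k → k < N + l →
      (∀ i, (Cx *ᵥ traj A B x0 u k) i < cx i) ∧ (∀ j, (Cu *ᵥ u k) j < cu j)) ∧
    (∀ r, (Ct *ᵥ traj A B x0 u (N + l)) r < ct r)}

section Trajectories

variable {n m : ℕ} {A : Matrix (Fin n) (Fin n) ℝ} {B : Matrix (Fin n) (Fin m) ℝ}
  {x0 : Fin n → ℝ}

lemma traj_congr {u v : ℕ → Fin m → ℝ} {M : ℕ} (h : ∀ k < M, u k = v k) :
    ∀ k ≤ M, traj A B x0 u k = traj A B x0 v k
  | 0, _ => rfl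
  | k + 1, hk => by simp only [traj, traj_congr h k (by omega), h k (by omega)]

lemma traj_add (u : ℕ → Fin m → ℝ) (M : ℕ) :
    ∀ i, traj A B x0 u (M + i) = traj A B (traj A B x0 u M) (fun k => u (M + k)) i
  | 0 => rfl
  | i + 1 => by rw [← add_assoc]; simp only [traj, traj_add u M i]

lemma traj_lineMap (u v : ℕ → Fin m → ℝ) (ε : ℝ) :
    ∀ k, traj A B x0 (fun i => u i + ε • (v i - u i)) k =
      traj A B x0 u k + ε • (traj A B x0 v k - traj A B x0 u k)
  | 0 => by simp [traj]
  | k + 1 => by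
    simp only [traj, traj_lineMap u v ε k, mulVec_add, mulVec_smul, mulVec_sub]
    module

/-- Follow `u` for the first `M` stages and `v`, started afresh, afterwards. -/
def splice (u : ℕ → Fin m → ℝ) (M : ℕ) (v : ℕ → Fin m → ℝ) : ℕ → Fin m → ℝ :=
  fun k => if k < M then u k else v (k - M)

lemma splice_of_lt {u v : ℕ → Fin m → ℝ} {M k : ℕ} (h : k < M) : splice u M v k = u k :=
  if_pos h

@[simp] lemma splice_add (u v : ℕ → Fin m → ℝ) (M i : ℕ) : splice u M v (M + i) = v i := by
  simp [splice]

lemma traj_splice_of_le {u v : ℕ → Fin m → ℝ} {M k : ℕ} (h : k ≤ M) :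
    traj A B x0 (splice u M v) k = traj A B x0 u k :=
  traj_congr (fun _ => splice_of_lt) k h

lemma traj_splice_add (u v : ℕ → Fin m → ℝ) (M i : ℕ) :
    traj A B x0 (splice u M v) (M + i) = traj A B (traj A B x0 u M) v i := by
  rw [traj_add, traj_splice_of_le le_rfl]
  simp

/-- The control sequence generated by the linear feedback `K` started at `x`. -/
def feedback (A : Matrix (Fin n) (Fin n) ℝ) (B : Matrix (Fin n) (Fin m) ℝ)
    (K : Matrix (Fin m) (Fin n) ℝ) (x : Fin n → ℝ) : ℕ → Fin m → ℝ :=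
  fun i => K *ᵥ (((A + B * K) ^ i) *ᵥ x)

lemma traj_of_eq_feedback {K : Matrix (Fin m) (Fin n) ℝ} {u : ℕ → Fin m → ℝ} {j : ℕ}
    (h : ∀ i < j, u i = K *ᵥ traj A B x0 u i) :
    ∀ i ≤ j, traj A B x0 u i = ((A + B * K) ^ i) *ᵥ x0
  | 0, _ => by simp [traj]
  | i + 1, hi => by
    rw [traj, h i (by omega), traj_of_eq_feedback h i (by omega), pow_succ', ← mulVec_mulVec,
      add_mulVec, mulVec_mulVec _ B K]

lemma traj_feedback (K : Matrix (Fin m) (Fin n) ℝ) (x : Fin n → ℝ) :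
    ∀ i, traj A B x (feedback A B K x) i = ((A + B * K) ^ i) *ᵥ x
  | 0 => by simp [traj]
  | i + 1 => by
    rw [traj, traj_feedback K x i, feedback, pow_succ', ← mulVec_mulVec, add_mulVec,
      mulVec_mulVec _ B K]

end Trajectories

section Halfspaces

variable {d q : ℕ} {C : Matrix (Fin q) (Fin d) ℝ} {c : Fin q → ℝ}

lemma eventually_mulVec_lineMap_le {a b : Fin d → ℝ} (ha : C *ᵥ a ≤ c)
    (h : (∀ i, (C *ᵥ a) i < c i) ∨ C *ᵥ b ≤ c) :
    ∀ᶠ ε : ℝ in nhdsWithin 0 (Ioi 0), C *ᵥ (a + ε • (b - a)) ≤ c := by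
  rcases h with h | h
  · have hc : ∀ᶠ ε : ℝ in nhds 0, ∀ i, (C *ᵥ (a + ε • (b - a))) i < c i := by
      refine Filter.eventually_all.2 fun i => ?_
      have hcont : Continuous fun ε : ℝ => (C *ᵥ (a + ε • (b - a))) i := by
        simp only [mulVec_add, mulVec_smul, Pi.add_apply, Pi.smul_apply]
        fun_prop
      exact hcont.continuousAt.eventually_lt continuousAt_const (by simpa using h i)
    filter_upwards [nhdsWithin_le_nhds hc] with ε hε i using (hε i).le
  · filter_upwards [Ioo_mem_nhdsGT (zero_lt_one' ℝ)] with ε hε i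
    have h1 := ha i
    have h2 := h i
    simp only [mulVec_add, mulVec_smul, mulVec_sub, Pi.add_apply, Pi.smul_apply, Pi.sub_apply,
      smul_eq_mul]
    nlinarith [hε.1, hε.2, mul_nonneg hε.1.le (sub_nonneg.2 h2),
      mul_nonneg (sub_nonneg.2 hε.2.le) (sub_nonneg.2 h1)]

lemma eventually_mulVec_smul_le {a : Fin d → ℝ} (h : ∀ i, (C *ᵥ a) i < c i) :
    ∀ᶠ t : ℝ in nhdsWithin 1 (Ioi 1), C *ᵥ (t • a) ≤ c := by
  have hc : ∀ᶠ t : ℝ in nhds 1, ∀ i, (C *ᵥ (t • a)) i < c i := by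
    refine Filter.eventually_all.2 fun i => ?_
    have hcont : Continuous fun t : ℝ => (C *ᵥ (t • a)) i := by
      simp only [mulVec_smul, Pi.smul_apply]
      fun_prop
    exact hcont.continuousAt.eventually_lt continuousAt_const (by simpa using h i)
  filter_upwards [nhdsWithin_le_nhds hc] with t ht i using (ht i).le

lemma mulVec_lt_of_smul_le {a : Fin d → ℝ} {t : ℝ} (hc : ∀ i, 0 < c i) (ht : 1 < t)
    (h : C *ᵥ (t • a) ≤ c) (i : Fin q) : (C *ᵥ a) i < c i := by
  have h1 := h i
  simp only [mulVec_smul, Pi.smul_apply, smul_eq_mul] at h1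
  by_contra! h2
  nlinarith [hc i, mul_lt_mul_of_pos_right ht (hc i)]

end Halfspaces

section Riccati

variable {n m : ℕ} {A : Matrix (Fin n) (Fin n) ℝ} {B : Matrix (Fin n) (Fin m) ℝ}
  {Q : Matrix (Fin n) (Fin n) ℝ} {R : Matrix (Fin m) (Fin m) ℝ} {P : Matrix (Fin n) (Fin n) ℝ}
  {K : Matrix (Fin m) (Fin n) ℝ} {S : Matrix (Fin m) (Fin m) ℝ}

/-- Completion of squares for a solution of the algebraic Riccati equation. -/
lemma riccati_completion (hR : Rᵀ = R) (hP : Pᵀ = P)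
    (hdet : IsUnit (R + Bᵀ * P * B).det)
    (hRic : P = Aᵀ * (P - P * B * (R + Bᵀ * P * B)⁻¹ * (Bᵀ * P)) * A + Q)
    (hK : K = -((Bᵀ * P * B + R)⁻¹ * (Bᵀ * P * A))) (x : Fin n → ℝ) (u : Fin m → ℝ) :
    x ⬝ᵥ (P *ᵥ x) + (u - K *ᵥ x) ⬝ᵥ ((R + Bᵀ * P * B) *ᵥ (u - K *ᵥ x)) =
      x ⬝ᵥ (Q *ᵥ x) + u ⬝ᵥ (R *ᵥ u) + (A *ᵥ x + B *ᵥ u) ⬝ᵥ (P *ᵥ (A *ᵥ x + B *ᵥ u)) := by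
  have adj : ∀ {p q : ℕ} (M : Matrix (Fin p) (Fin q) ℝ) (y : Fin q → ℝ) (z : Fin p → ℝ),
      (M *ᵥ y) ⬝ᵥ z = y ⬝ᵥ (Mᵀ *ᵥ z) := fun M y z => by
    rw [dotProduct_comm, dotProduct_mulVec, ← mulVec_transpose, dotProduct_comm]
  rw [add_comm (Bᵀ * P * B) R] at hK
  have hSt : (R + Bᵀ * P * B)ᵀ = R + Bᵀ * P * B := by
    simp [transpose_mul, hR, hP, Matrix.mul_assoc]
  have hSK : (R + Bᵀ * P * B) * K = -(Bᵀ * P * A) := by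
    rw [hK, Matrix.mul_neg, Matrix.mul_nonsing_inv_cancel_left _ _ hdet]
  have hKS : Kᵀ * (R + Bᵀ * P * B) = -(Aᵀ * P * B) := by
    have := congrArg transpose hSK
    rw [transpose_mul, hSt] at this
    rw [this]
    simp [transpose_mul, hP, Matrix.mul_assoc]
  have hPQ : P = Aᵀ * P * A + Aᵀ * P * B * K + Q := by
    conv_lhs => rw [hRic]
    rw [hK]
    simp only [Matrix.mul_sub, Matrix.sub_mul, Matrix.mul_neg, Matrix.mul_assoc]
    abel
  set S := R + Bᵀ * P * B with hS
  have e1 : (u - K *ᵥ x) ⬝ᵥ (S *ᵥ (u - K *ᵥ x)) =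
      u ⬝ᵥ (S *ᵥ u) - u ⬝ᵥ ((S * K) *ᵥ x) - x ⬝ᵥ ((Kᵀ * S) *ᵥ u)
        + x ⬝ᵥ ((Kᵀ * S * K) *ᵥ x) := by
    simp only [mulVec_sub, sub_dotProduct, dotProduct_sub, adj, mulVec_mulVec, Matrix.mul_assoc]
    ring
  have e2 : (A *ᵥ x + B *ᵥ u) ⬝ᵥ (P *ᵥ (A *ᵥ x + B *ᵥ u)) =
      x ⬝ᵥ ((Aᵀ * P * A) *ᵥ x) + x ⬝ᵥ ((Aᵀ * P * B) *ᵥ u) + u ⬝ᵥ ((Bᵀ * P * A) *ᵥ x)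
        + u ⬝ᵥ ((Bᵀ * P * B) *ᵥ u) := by
    simp only [mulVec_add, add_dotProduct, dotProduct_add, adj, mulVec_mulVec, Matrix.mul_assoc]
    ring
  have e3 : x ⬝ᵥ (P *ᵥ x) = x ⬝ᵥ ((Aᵀ * P * A) *ᵥ x) + x ⬝ᵥ ((Aᵀ * P * B * K) *ᵥ x)
      + x ⬝ᵥ (Q *ᵥ x) := by
    conv_lhs => rw [hPQ]
    simp only [add_mulVec, dotProduct_add]
  have e4 : u ⬝ᵥ (S *ᵥ u) = u ⬝ᵥ (R *ᵥ u) + u ⬝ᵥ ((Bᵀ * P * B) *ᵥ u) := by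
    rw [hS, add_mulVec, dotProduct_add]
  rw [e1, e2, e3, e4, hSK, hKS]
  simp only [Matrix.neg_mul, neg_mulVec, dotProduct_neg]
  ring

lemma dotProduct_mulVec_lineMap (S : Matrix (Fin m) (Fin m) ℝ) (a b : Fin m → ℝ) (ε : ℝ) :
    (a + ε • (b - a)) ⬝ᵥ (S *ᵥ (a + ε • (b - a))) =
      (1 - ε) * (a ⬝ᵥ (S *ᵥ a)) + ε * (b ⬝ᵥ (S *ᵥ b))
        - ε * (1 - ε) * ((b - a) ⬝ᵥ (S *ᵥ (b - a))) := by
  simp only [mulVec_add, mulVec_smul, mulVec_sub, add_dotProduct, dotProduct_add, smul_dotProduct,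
    dotProduct_smul, sub_dotProduct, dotProduct_sub, smul_eq_mul]
  ring

lemma Matrix.PosDef.dotProduct_mulVec_self_nonneg (hS : S.PosDef) (a : Fin m → ℝ) :
    0 ≤ a ⬝ᵥ (S *ᵥ a) :=
  hS.posSemidef.dotProduct_mulVec_nonneg a

/-- The `S`-weighted square of the deviation `u(k) - K x(k)` from the feedback law. -/
def deviation (A : Matrix (Fin n) (Fin n) ℝ) (B : Matrix (Fin n) (Fin m) ℝ)
    (K : Matrix (Fin m) (Fin n) ℝ) (S : Matrix (Fin m) (Fin m) ℝ)
    (x0 : Fin n → ℝ) (u : ℕ → Fin m → ℝ) (k : ℕ) : ℝ :=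
  (u k - K *ᵥ traj A B x0 u k) ⬝ᵥ (S *ᵥ (u k - K *ᵥ traj A B x0 u k))

lemma deviation_nonneg (hS : S.PosDef) (x0 : Fin n → ℝ) (u : ℕ → Fin m → ℝ) (k : ℕ) :
    0 ≤ deviation A B K S x0 u k :=
  hS.dotProduct_mulVec_self_nonneg _

lemma eq_zero_of_dotProduct_mulVec_nonpos (hS : S.PosDef) {a : Fin m → ℝ}
    (h : a ⬝ᵥ (S *ᵥ a) ≤ 0) : a = 0 := by
  by_contra ha
  have := hS.dotProduct_mulVec_pos ha
  simp only [star_trivial] at this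
  linarith

variable (hid : ∀ (x : Fin n → ℝ) (u : Fin m → ℝ),
    x ⬝ᵥ (P *ᵥ x) + (u - K *ᵥ x) ⬝ᵥ (S *ᵥ (u - K *ᵥ x)) =
      x ⬝ᵥ (Q *ᵥ x) + u ⬝ᵥ (R *ᵥ u) + (A *ᵥ x + B *ᵥ u) ⬝ᵥ (P *ᵥ (A *ᵥ x + B *ᵥ u)))
include hid

lemma cost_eq_sum_deviation (x0 : Fin n → ℝ) (u : ℕ → Fin m → ℝ) (N : ℕ) :
    cost A B Q R P N x0 u = (1 / 2) * (x0 ⬝ᵥ (P *ᵥ x0)) +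
      (1 / 2) * ∑ k ∈ Finset.range N, deviation A B K S x0 u k := by
  induction N with
  | zero => simp [cost, traj]
  | succ N ih =>
    have h := hid (traj A B x0 u N) (u N)
    simp only [cost] at ih ⊢
    rw [Finset.sum_range_succ, Finset.sum_range_succ, traj, deviation]
    linarith

lemma cost_lineMap (x0 : Fin n → ℝ) (u v : ℕ → Fin m → ℝ) (N : ℕ) (ε : ℝ) :
    cost A B Q R P N x0 (fun i => u i + ε • (v i - u i)) =
      (1 - ε) * cost A B Q R P N x0 u + ε * cost A B Q R P N x0 v
        - ε * (1 - ε) * ((1 / 2) * ∑ k ∈ Finset.range N,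
          ((v k - K *ᵥ traj A B x0 v k) - (u k - K *ᵥ traj A B x0 u k)) ⬝ᵥ
            (S *ᵥ ((v k - K *ᵥ traj A B x0 v k) - (u k - K *ᵥ traj A B x0 u k)))) := by
  have hk : ∀ k, deviation A B K S x0 (fun i => u i + ε • (v i - u i)) k =
      (1 - ε) * deviation A B K S x0 u k + ε * deviation A B K S x0 v k -
        ε * (1 - ε) * (((v k - K *ᵥ traj A B x0 v k) - (u k - K *ᵥ traj A B x0 u k)) ⬝ᵥ
            (S *ᵥ ((v k - K *ᵥ traj A B x0 v k) - (u k - K *ᵥ traj A B x0 u k)))) := fun k => by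
    have he : u k + ε • (v k - u k) -
        K *ᵥ (traj A B x0 u k + ε • (traj A B x0 v k - traj A B x0 u k)) =
          (u k - K *ᵥ traj A B x0 u k) +
            ε • ((v k - K *ᵥ traj A B x0 v k) - (u k - K *ᵥ traj A B x0 u k)) := by
      simp only [mulVec_add, mulVec_smul, mulVec_sub]
      module
    rw [deviation, deviation, deviation, ← dotProduct_mulVec_lineMap, traj_lineMap, he]
  simp only [cost_eq_sum_deviation hid, hk, Finset.sum_sub_distrib, Finset.sum_add_distrib,
    ← Finset.mul_sum]
  ring

lemma cost_mono_horizon (hS : S.PosDef) (x0 : Fin n → ℝ) (u : ℕ → Fin m → ℝ) (M j : ℕ) :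
    cost A B Q R P M x0 u ≤ cost A B Q R P (M + j) x0 u := by
  rw [cost_eq_sum_deviation hid, cost_eq_sum_deviation hid, Finset.sum_range_add]
  have := Finset.sum_nonneg fun i (_ : i ∈ Finset.range j) =>
    deviation_nonneg (A := A) (B := B) (K := K) hS x0 u (M + i)
  linarith

lemma cost_splice_feedback (x0 : Fin n → ℝ) (u : ℕ → Fin m → ℝ) (M j : ℕ) :
    cost A B Q R P (M + j) x0 (splice u M (feedback A B K (traj A B x0 u M))) =
      cost A B Q R P M x0 u := by
  rw [cost_eq_sum_deviation hid, cost_eq_sum_deviation hid, Finset.sum_range_add]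
  have h1 : ∀ k ∈ Finset.range M,
      deviation A B K S x0 (splice u M (feedback A B K (traj A B x0 u M))) k =
        deviation A B K S x0 u k := fun k hk => by
    have hk := Finset.mem_range.1 hk
    rw [deviation, deviation, splice_of_lt hk, traj_splice_of_le hk.le]
  have h2 : ∀ i ∈ Finset.range j,
      deviation A B K S x0 (splice u M (feedback A B K (traj A B x0 u M))) (M + i) = 0 :=
    fun i _ => by
      rw [deviation, splice_add, traj_splice_add, traj_feedback, feedback]
      simp
  rw [Finset.sum_congr rfl h1, Finset.sum_eq_zero h2, add_zero]

end Riccati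

lemma cost_add {n m : ℕ} (A : Matrix (Fin n) (Fin n) ℝ) (B : Matrix (Fin n) (Fin m) ℝ)
    (Q : Matrix (Fin n) (Fin n) ℝ) (R : Matrix (Fin m) (Fin m) ℝ) (P : Matrix (Fin n) (Fin n) ℝ)
    (x0 : Fin n → ℝ) (u : ℕ → Fin m → ℝ) (l M : ℕ) :
    cost A B Q R P (l + M) x0 u =
      (1 / 2) * ∑ k ∈ Finset.range l,
        (traj A B x0 u k ⬝ᵥ (Q *ᵥ traj A B x0 u k) + u k ⬝ᵥ (R *ᵥ u k)) +
      cost A B Q R P M (traj A B x0 u l) (fun k => u (l + k)) := by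
  simp only [cost, Finset.sum_range_add, ← traj_add]
  ring

section Optimality

variable {n m qX qU qT : ℕ} {A : Matrix (Fin n) (Fin n) ℝ} {B : Matrix (Fin n) (Fin m) ℝ}
  {Q : Matrix (Fin n) (Fin n) ℝ} {R : Matrix (Fin m) (Fin m) ℝ} {P : Matrix (Fin n) (Fin n) ℝ}
  {K : Matrix (Fin m) (Fin n) ℝ} {S : Matrix (Fin m) (Fin m) ℝ}
  {Cx : Matrix (Fin qX) (Fin n) ℝ} {cx : Fin qX → ℝ}
  {Cu : Matrix (Fin qU) (Fin m) ℝ} {cu : Fin qU → ℝ}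
  {Ct : Matrix (Fin qT) (Fin n) ℝ} {ct : Fin qT → ℝ}

lemma Feasible.splice {l M : ℕ} {x0 : Fin n → ℝ} {u v : ℕ → Fin m → ℝ}
    (hu : ∀ k < l, Cx *ᵥ traj A B x0 u k ≤ cx ∧ Cu *ᵥ u k ≤ cu)
    (hv : Feasible A B Cx cx Cu cu Ct ct M (traj A B x0 u l) v) :
    Feasible A B Cx cx Cu cu Ct ct (l + M) x0 (splice u l v) := by
  refine ⟨fun k hk => ?_, by rw [traj_splice_add]; exact hv.2⟩
  rcases lt_or_ge k l with h | h
  · rw [traj_splice_of_le h.le, splice_of_lt h]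
    exact hu k h
  · obtain ⟨i, rfl⟩ := Nat.exists_eq_add_of_le h
    rw [traj_splice_add, splice_add]
    exact hv.1 i (by omega)

/-- Tails of optimal sequences are optimal. -/
lemma IsOptimal.tail {l M : ℕ} {x0 : Fin n → ℝ} {u : ℕ → Fin m → ℝ}
    (h : IsOptimal A B Q R P Cx cx Cu cu Ct ct (l + M) x0 u) :
    IsOptimal A B Q R P Cx cx Cu cu Ct ct M (traj A B x0 u l) (fun k => u (l + k)) := by
  refine ⟨⟨fun k hk => ?_, ?_⟩, fun v hv => ?_⟩
  · rw [← traj_add]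
    exact h.1.1 (l + k) (by omega)
  · rw [← traj_add]
    exact h.1.2
  · have hle := h.2 _ (Feasible.splice (fun k hk => h.1.1 k (by omega)) hv)
    rw [cost_add, cost_add, traj_splice_of_le le_rfl] at hle
    simp only [splice_add] at hle
    have hsum : ∀ k ∈ Finset.range l,
        traj A B x0 (splice u l v) k ⬝ᵥ (Q *ᵥ traj A B x0 (splice u l v) k) +
            splice u l v k ⬝ᵥ (R *ᵥ splice u l v k) =
          traj A B x0 u k ⬝ᵥ (Q *ᵥ traj A B x0 u k) + u k ⬝ᵥ (R *ᵥ u k) := fun k hk => by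
      have hk := Finset.mem_range.1 hk
      rw [traj_splice_of_le hk.le, splice_of_lt hk]
    rw [Finset.sum_congr rfl hsum] at hle
    linarith

variable (hS : S.PosDef) (hid : ∀ (x : Fin n → ℝ) (u : Fin m → ℝ),
    x ⬝ᵥ (P *ᵥ x) + (u - K *ᵥ x) ⬝ᵥ (S *ᵥ (u - K *ᵥ x)) =
      x ⬝ᵥ (Q *ᵥ x) + u ⬝ᵥ (R *ᵥ u) + (A *ᵥ x + B *ᵥ u) ⬝ᵥ (P *ᵥ (A *ᵥ x + B *ᵥ u)))
include hid

/-- An optimal sequence is at least as good as any sequence that only violates constraints which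
are inactive along the optimal one; the gap is bounded below by the distance between the two. -/
lemma IsOptimal.exists_gap {N : ℕ} {x0 : Fin n → ℝ} {u v : ℕ → Fin m → ℝ}
    (h : IsOptimal A B Q R P Cx cx Cu cu Ct ct N x0 u)
    (hx : ∀ k < N, (∀ i, (Cx *ᵥ traj A B x0 u k) i < cx i) ∨ Cx *ᵥ traj A B x0 v k ≤ cx)
    (hu : ∀ k < N, (∀ i, (Cu *ᵥ u k) i < cu i) ∨ Cu *ᵥ v k ≤ cu)
    (ht : (∀ i, (Ct *ᵥ traj A B x0 u N) i < ct i) ∨ Ct *ᵥ traj A B x0 v N ≤ ct) :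
    ∃ δ : ℝ, 0 < δ ∧ cost A B Q R P N x0 u + δ * ((1 / 2) * ∑ k ∈ Finset.range N,
          ((v k - K *ᵥ traj A B x0 v k) - (u k - K *ᵥ traj A B x0 u k)) ⬝ᵥ
            (S *ᵥ ((v k - K *ᵥ traj A B x0 v k) - (u k - K *ᵥ traj A B x0 u k)))) ≤
      cost A B Q R P N x0 v := by
  have hev : ∀ᶠ ε : ℝ in nhdsWithin 0 (Ioi 0), Feasible A B Cx cx Cu cu Ct ct N x0
      (fun i => u i + ε • (v i - u i)) := by
    have h1 : ∀ᶠ ε : ℝ in nhdsWithin 0 (Ioi 0), ∀ k ∈ Iio N,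
        Cx *ᵥ (traj A B x0 u k + ε • (traj A B x0 v k - traj A B x0 u k)) ≤ cx ∧
          Cu *ᵥ (u k + ε • (v k - u k)) ≤ cu :=
      (Filter.eventually_all_finite (finite_Iio N)).2 fun k hk =>
        (eventually_mulVec_lineMap_le (h.1.1 k hk).1 (hx k hk)).and
          (eventually_mulVec_lineMap_le (h.1.1 k hk).2 (hu k hk))
    filter_upwards [h1, eventually_mulVec_lineMap_le h.1.2 ht] with ε hε1 hε2
    refine ⟨fun k hk => ?_, ?_⟩
    · rw [traj_lineMap]
      exact hε1 k hk
    · rw [traj_lineMap]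
      exact hε2
  obtain ⟨ε, hε, hε0, hε1⟩ := (hev.and (Ioo_mem_nhdsGT (zero_lt_one' ℝ))).exists
  have hle := h.2 _ hε
  rw [cost_lineMap hid] at hle
  refine ⟨1 - ε, sub_pos.2 hε1, le_of_mul_le_mul_left ?_ hε0⟩
  linarith

include hS

lemma IsOptimal.cost_le {N : ℕ} {x0 : Fin n → ℝ} {u v : ℕ → Fin m → ℝ}
    (h : IsOptimal A B Q R P Cx cx Cu cu Ct ct N x0 u)
    (hx : ∀ k < N, (∀ i, (Cx *ᵥ traj A B x0 u k) i < cx i) ∨ Cx *ᵥ traj A B x0 v k ≤ cx)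
    (hu : ∀ k < N, (∀ i, (Cu *ᵥ u k) i < cu i) ∨ Cu *ᵥ v k ≤ cu)
    (ht : (∀ i, (Ct *ᵥ traj A B x0 u N) i < ct i) ∨ Ct *ᵥ traj A B x0 v N ≤ ct) :
    cost A B Q R P N x0 u ≤ cost A B Q R P N x0 v := by
  obtain ⟨δ, hδ, hle⟩ := h.exists_gap hid hx hu ht
  have := mul_nonneg hδ.le (mul_nonneg one_half_pos.le (Finset.sum_nonneg
    fun k (_ : k ∈ Finset.range N) => hS.dotProduct_mulVec_self_nonneg
      ((v k - K *ᵥ traj A B x0 v k) - (u k - K *ᵥ traj A B x0 u k))))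
  linarith

lemma IsOptimal.unique {N : ℕ} {x0 : Fin n → ℝ} {u v : ℕ → Fin m → ℝ}
    (hu : IsOptimal A B Q R P Cx cx Cu cu Ct ct N x0 u)
    (hv : IsOptimal A B Q R P Cx cx Cu cu Ct ct N x0 v) : ∀ k < N, u k = v k := by
  obtain ⟨δ, hδ, hle⟩ := hu.exists_gap (v := v) hid (fun k hk => .inr (hv.1.1 k hk).1)
    (fun k hk => .inr (hv.1.1 k hk).2) (.inr hv.1.2)
  have hvu := hv.2 u hu.1
  have hsum := (mul_nonpos_iff_pos_imp_nonpos.1 (le_of_add_le_add_left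
    ((hle.trans hvu).trans_eq (add_zero _).symm))).1 hδ
  have hnn : ∀ k ∈ Finset.range N,
      0 ≤ ((v k - K *ᵥ traj A B x0 v k) - (u k - K *ᵥ traj A B x0 u k)) ⬝ᵥ
        (S *ᵥ ((v k - K *ᵥ traj A B x0 v k) - (u k - K *ᵥ traj A B x0 u k))) := fun k _ =>
    hS.dotProduct_mulVec_self_nonneg _
  have hdev : ∀ k < N, v k - K *ᵥ traj A B x0 v k = u k - K *ᵥ traj A B x0 u k := fun k hk => by
    refine sub_eq_zero.1 (eq_zero_of_dotProduct_mulVec_nonpos hS ?_)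
    have := Finset.single_le_sum hnn (Finset.mem_range.2 hk)
    linarith
  intro k
  induction k using Nat.strong_induction_on with
  | _ k ih =>
    intro hk
    have h1 := hdev k hk
    rw [traj_congr (fun i hi => ih i hi (hi.trans hk)) k le_rfl] at h1
    exact (sub_left_injective h1).symm

/-- If no constraint is active from stage `M` on, the optimal inputs follow the feedback law. -/
lemma IsOptimal.eq_feedback {M j : ℕ} {x0 : Fin n → ℝ} {u : ℕ → Fin m → ℝ}
    (h : IsOptimal A B Q R P Cx cx Cu cu Ct ct (M + j) x0 u)
    (hin : ∀ k, M ≤ k → k < M + j →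
      (∀ i, (Cx *ᵥ traj A B x0 u k) i < cx i) ∧ (∀ i, (Cu *ᵥ u k) i < cu i))
    (ht : ∀ r, (Ct *ᵥ traj A B x0 u (M + j)) r < ct r) :
    ∀ i < j, u (M + i) = K *ᵥ traj A B x0 u (M + i) := by
  have hle := h.cost_le (v := splice u M (feedback A B K (traj A B x0 u M))) hS hid
    (fun k hk => by
      rcases lt_or_ge k M with hkM | hkM
      · right
        rw [traj_splice_of_le hkM.le]
        exact (h.1.1 k hk).1
      · exact .inl (hin k hkM hk).1)
    (fun k hk => by
      rcases lt_or_ge k M with hkM | hkM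
      · right
        rw [splice_of_lt hkM]
        exact (h.1.1 k hk).2
      · exact .inl (hin k hkM hk).2)
    (.inl ht)
  rw [cost_splice_feedback hid, cost_eq_sum_deviation hid, cost_eq_sum_deviation hid,
    Finset.sum_range_add] at hle
  intro i hi
  refine sub_eq_zero.1 (eq_zero_of_dotProduct_mulVec_nonpos hS ?_)
  have := Finset.single_le_sum (fun i (_ : i ∈ Finset.range j) =>
    deviation_nonneg (A := A) (B := B) (K := K) hS x0 u (M + i)) (Finset.mem_range.2 hi)
  change deviation A B K S x0 u (M + i) ≤ 0
  linarith

variable (hcx : ∀ i, 0 < cx i) (hcu : ∀ i, 0 < cu i) (hct : ∀ i, 0 < ct i)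
  (hT : ∀ x, Ct *ᵥ x ≤ ct ↔ ∀ k : ℕ,
    Cx *ᵥ (((A + B * K) ^ k) *ᵥ x) ≤ cx ∧ Cu *ᵥ (K *ᵥ (((A + B * K) ^ k) *ᵥ x)) ≤ cu)
include hcx hcu hct hT

/-- Appending inactive stages to an active pattern without active terminal rows does not change
the corresponding set of initial states. -/
lemma polyPad_zero_eq (M j : ℕ) (α : ℕ → Set (Fin qX) × Set (Fin qU)) :
    PolyPad A B Q R P Cx cx Cu cu Ct ct M 0 α = PolyPad A B Q R P Cx cx Cu cu Ct ct M j α := by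
  have hinv : ∀ x, Ct *ᵥ x ≤ ct → ∀ k : ℕ, Ct *ᵥ (((A + B * K) ^ k) *ᵥ x) ≤ ct :=
    fun x hx k => (hT _).2 fun i => by
      simpa only [mulVec_mulVec, Matrix.mul_assoc, pow_add] using (hT x).1 hx (i + k)
  have hcomm : ∀ (t : ℝ) (x : Fin n → ℝ) (k : ℕ),
      ((A + B * K) ^ k) *ᵥ (t • x) = t • (((A + B * K) ^ k) *ᵥ x) :=
    fun t x k => mulVec_smul _ _ _
  ext x0
  constructor
  · rintro ⟨u, hopt, hpat, -, hter⟩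
    simp only [add_zero] at hopt hter
    set x := traj A B x0 u M
    obtain ⟨t, ht, ht1⟩ := ((eventually_mulVec_smul_le hter).and self_mem_nhdsWithin).exists
    have hxT := (hT x).1 hopt.1.2
    have htT := (hT _).1 ht
    have hfeas : ∀ v, Feasible A B Cx cx Cu cu Ct ct M x0 v →
        Feasible A B Cx cx Cu cu Ct ct (M + j) x0
          (splice v M (feedback A B K (traj A B x0 v M))) := fun v hv =>
      Feasible.splice hv.1 ⟨fun k _ => by
        rw [traj_feedback]
        exact (hT _).1 hv.2 k, by
        rw [traj_feedback]
        exact hinv _ hv.2 j⟩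
    refine ⟨splice u M (feedback A B K x), ⟨hfeas u hopt.1, fun v hv => ?_⟩, fun k hk => ?_,
      fun k hk hkj => ?_, fun r => ?_⟩
    · rw [cost_splice_feedback hid]
      exact (hopt.cost_le hS hid (fun k hk => .inr (hv.1 k (by omega)).1)
        (fun k hk => .inr (hv.1 k (by omega)).2) (.inl hter)).trans
          (cost_mono_horizon hid hS x0 v M j)
    · rw [traj_splice_of_le hk.le, splice_of_lt hk]
      exact hpat k hk
    · obtain ⟨i, rfl⟩ := Nat.exists_eq_add_of_le hk
      rw [traj_splice_add, splice_add, traj_feedback, feedback]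
      have h := htT i
      rw [hcomm, mulVec_smul K] at h
      exact ⟨mulVec_lt_of_smul_le hcx ht1 h.1, mulVec_lt_of_smul_le hcu ht1 h.2⟩
    · rw [traj_splice_add, traj_feedback]
      refine mulVec_lt_of_smul_le hct ht1 ?_ r
      rw [← hcomm]
      exact hinv _ ht j
  · rintro ⟨u, hopt, hpat, hin, hter⟩
    set x := traj A B x0 u M
    have hfb := hopt.eq_feedback hS hid hin hter
    have htr : ∀ i ≤ j, traj A B x0 u (M + i) = ((A + B * K) ^ i) *ᵥ x := fun i hi => by
      rw [traj_add]
      exact traj_of_eq_feedback (fun i hi => by rw [← traj_add]; exact hfb i hi) i hi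
    have hev : ∀ᶠ t : ℝ in nhdsWithin 1 (Ioi 1), ∀ i ∈ Iio j,
        Cx *ᵥ (t • traj A B x0 u (M + i)) ≤ cx ∧ Cu *ᵥ (t • u (M + i)) ≤ cu :=
      (Filter.eventually_all_finite (finite_Iio j)).2 fun i hi => by
        have hi' : i < j := hi
        have := hin (M + i) (by omega) (by omega)
        exact (eventually_mulVec_smul_le this.1).and (eventually_mulVec_smul_le this.2)
    obtain ⟨t, ⟨ht, htT⟩, ht1⟩ :=
      ((hev.and (eventually_mulVec_smul_le hter)).and self_mem_nhdsWithin).exists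
    have hxt : Ct *ᵥ (t • x) ≤ ct := by
      refine (hT _).2 fun k => ?_
      rcases lt_or_ge k j with hk | hk
      · have h := ht k hk
        rwa [hfb k hk, htr k hk.le, ← mulVec_smul K, ← hcomm] at h
      · obtain ⟨i, rfl⟩ := Nat.exists_eq_add_of_le' hk
        rw [htr j le_rfl, ← hcomm] at htT
        simpa only [mulVec_mulVec, Matrix.mul_assoc, pow_add] using (hT _).1 htT i
    have hxT := mulVec_lt_of_smul_le hct ht1 hxt
    refine ⟨u, ⟨⟨fun k hk => hopt.1.1 k (by omega), fun r => (hxT r).le⟩, fun v hv => ?_⟩, hpat,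
      fun k hk hk' => absurd hk' (by omega), hxT⟩
    rw [add_zero] at hv ⊢
    refine (cost_mono_horizon hid hS x0 u M j).trans
      ((hopt.2 _ (Feasible.splice hv.1 ⟨fun k _ => ?_, ?_⟩)).trans
        (cost_splice_feedback hid x0 v M j).le)
    · rw [traj_feedback]
      exact (hT _).1 hv.2 k
    · rw [traj_feedback]
      exact hinv _ hv.2 j

end Optimality

/-- truncations of a persistent active pattern define persistent polytopes:
`P_{N-l}(α_l,…,α_{N-1}) = P_{N-l+j}((α_l,…,α_{N-1})0^j)`; in particular the truncated
pattern padded with `l` inactive stages defines the same polytope at horizon `N`; and the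
optimal state `x*_N(x0,l)` of any `x0 ∈ P_N(α)` lies in `P_{N-l}(α_l,…,α_{N-1})`. -/
theorem stmt5
    {n m qX qU qT : ℕ}
    (A : Matrix (Fin n) (Fin n) ℝ) (B : Matrix (Fin n) (Fin m) ℝ)
    (Q : Matrix (Fin n) (Fin n) ℝ) (R : Matrix (Fin m) (Fin m) ℝ)
    (P : Matrix (Fin n) (Fin n) ℝ)
    (Cx : Matrix (Fin qX) (Fin n) ℝ) (cx : Fin qX → ℝ)
    (Cu : Matrix (Fin qU) (Fin m) ℝ) (cu : Fin qU → ℝ)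
    (Ct : Matrix (Fin qT) (Fin n) ℝ) (ct : Fin qT → ℝ)
    (hQ : Q.PosSemidef) (hR : R.PosDef) (hP : P.PosSemidef)
    (Kinf : Matrix (Fin m) (Fin n) ℝ)
    (hdet : IsUnit (R + Bᵀ * P * B).det)
    (hRic : P = Aᵀ * (P - P * B * (R + Bᵀ * P * B)⁻¹ * (Bᵀ * P)) * A + Q)
    (hK : Kinf = -((Bᵀ * P * B + R)⁻¹ * (Bᵀ * P * A)))
    (Xs : Set (Fin n → ℝ)) (hXs : Xs = {x | Cx *ᵥ x ≤ cx})
    (Us : Set (Fin m → ℝ)) (hUs : Us = {v | Cu *ᵥ v ≤ cu})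
    (Ts : Set (Fin n → ℝ)) (hTs : Ts = {x | Ct *ᵥ x ≤ ct})
    (XU : Set (Fin n → ℝ)) (hXU : XU = {x ∈ Xs | Kinf *ᵥ x ∈ Us})
    (hTchar : Ts = {x ∈ Xs | ∀ k : ℕ, ((A + B * Kinf) ^ k) *ᵥ x ∈ XU})
    (hXc : IsCompact Xs) (hUc : IsCompact Us) (hTc : IsCompact Ts)
    (hX0 : (0 : Fin n → ℝ) ∈ interior Xs)
    (hU0 : (0 : Fin m → ℝ) ∈ interior Us)
    (hT0 : (0 : Fin n → ℝ) ∈ interior Ts)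
    (hXint : interior Xs = {x | ∀ i, (Cx *ᵥ x) i < cx i})
    (hUint : interior Us = {v | ∀ j, (Cu *ᵥ v) j < cu j})
    (hTint : interior Ts = {x | ∀ r, (Ct *ᵥ x) r < ct r})
    (N : ℕ) (hN : 1 ≤ N) (α : ℕ → Set (Fin qX) × Set (Fin qU)) :
    (∀ l, l ≤ N - 1 → ∀ j : ℕ,
      PolyPad A B Q R P Cx cx Cu cu Ct ct (N - l) 0 (fun k => α (l + k)) = PolyPad A B Q R P Cx cx Cu cu Ct ct (N - l) j (fun k => α (l + k))) ∧
    (∀ l, l ≤ N - 1 →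
      PolyPad A B Q R P Cx cx Cu cu Ct ct (N - l) 0 (fun k => α (l + k)) = PolyPad A B Q R P Cx cx Cu cu Ct ct (N - l) l (fun k => α (l + k))) ∧
    (∀ x0 ∈ PolyPad A B Q R P Cx cx Cu cu Ct ct N 0 α, ∀ u, IsOptimal A B Q R P Cx cx Cu cu Ct ct N x0 u → ∀ l, l ≤ N - 1 →
      traj A B x0 u l ∈ PolyPad A B Q R P Cx cx Cu cu Ct ct (N - l) 0 (fun k => α (l + k))) := by
  have hS : (R + Bᵀ * P * B).PosDef :=
    hR.add_posSemidef (by simpa using hP.conjTranspose_mul_mul_same B)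
  have hRt : Rᵀ = R := by simpa using hR.isHermitian.eq
  have hPt : Pᵀ = P := by simpa using hP.isHermitian.eq
  have hid := riccati_completion hRt hPt hdet hRic hK
  have hcx : ∀ i, 0 < cx i := by simpa [hXint] using hX0
  have hcu : ∀ i, 0 < cu i := by simpa [hUint] using hU0
  have hct : ∀ i, 0 < ct i := by simpa [hTint] using hT0
  have hT : ∀ x, Ct *ᵥ x ≤ ct ↔ ∀ k : ℕ, Cx *ᵥ (((A + B * Kinf) ^ k) *ᵥ x) ≤ cx ∧
      Cu *ᵥ (Kinf *ᵥ (((A + B * Kinf) ^ k) *ᵥ x)) ≤ cu := fun x => by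
    have h := Set.ext_iff.1 (hTs.symm.trans hTchar) x
    simp only [hXU, hXs, hUs, mem_ofPred_eq] at h
    rw [h]
    exact and_iff_right_of_imp fun h => by simpa using (h 0).1
  have hpad := polyPad_zero_eq hS hid hcx hcu hct hT
  refine ⟨fun l _ j => hpad _ j _, fun l _ => hpad _ l _, ?_⟩
  rintro x0 ⟨v, hv, hpat, -, hter⟩ u hu l hl
  obtain ⟨M, rfl⟩ := Nat.exists_eq_add_of_le (show l ≤ N by omega)
  rw [Nat.add_sub_cancel_left]
  have huv := hu.unique hS hid hv
  have htr := traj_congr (A := A) (B := B) (x0 := x0) huv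
  refine ⟨fun k => u (l + k), hu.tail, fun k hk => ?_, fun k hk hk' => absurd hk' (by omega), ?_⟩
  · have hlk : l + k < l + M := by omega
    rw [← traj_add, htr _ hlk.le]
    beta_reduce
    rw [huv _ hlk]
    exact hpat (l + k) hlk
  · rw [add_zero, ← traj_add, htr _ le_rfl]
    exact hter
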